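/- arXiv:math/0406415 — 2 statements merged into one kernel-verified Lean document; each statement's English description precedes it below -/
import Mathlib

section
/- Let A be a domain over a field k with finite transcendence degree over k, and let φ be a nontrivial exponential map on A. Then trdeg_k(A^φ) = trdeg_k(A) - 1. -/
/-- An exponential map on a `k`-algebra `A`. -/
def IsExpMap {k A : Type*} [CommSemiring k] [CommRing A] [Algebra k A]
    (φ : A →ₐ[k] Polynomial A) : Prop :=
  (∀ a : A, (φ a).eval 0 = a) ∧
  (∀ a : A, (φ a).map φ.toRingHom =
      Polynomial.eval₂ (Polynomial.C.comp Polynomial.C)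
        (Polynomial.X + Polynomial.C Polynomial.X) (φ a))

/-- The ring of invariants `A^φ` of an exponential map, as a subalgebra of `A`. -/
def expInvariants {k A : Type*} [CommSemiring k] [CommRing A] [Algebra k A]
    (φ : A →ₐ[k] Polynomial A) : Subalgebra k A where
  carrier := {a : A | φ a = Polynomial.C a}
  mul_mem' := fun {a b} ha hb => by
    simp only [Set.mem_setOf_eq] at *
    rw [map_mul, ha, hb, ← map_mul]
  add_mem' := fun {a b} ha hb => by
    simp only [Set.mem_setOf_eq] at *
    rw [map_add, ha, hb, ← map_add]
  algebraMap_mem' := fun r => by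
    simp only [Set.mem_setOf_eq, AlgHom.commutes, Polynomial.algebraMap_apply]

open Polynomial

section

variable {k A : Type*} [CommSemiring k] [CommRing A] [Algebra k A] {φ : A →ₐ[k] A[X]}

theorem mem_expInvariants {a : A} : a ∈ expInvariants φ ↔ φ a = C a := Iff.rfl

/-- An exponential map is linear over its ring of invariants. -/
def expInvariantsAlgHom (φ : A →ₐ[k] A[X]) : A →ₐ[expInvariants φ] A[X] where
  __ := φ.toRingHom
  commutes' b := b.2

@[simp]
theorem expInvariantsAlgHom_apply (a : A) : expInvariantsAlgHom φ a = φ a := rfl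

/-- The elements of `A` whose image under an exponential map has degree less than `n`. -/
noncomputable def expDegreeLT (φ : A →ₐ[k] A[X]) (n : ℕ) : Submodule (expInvariants φ) A :=
  ((degreeLT A n).restrictScalars (expInvariants φ)).comap (expInvariantsAlgHom φ).toLinearMap

theorem mem_expDegreeLT {n : ℕ} {a : A} :
    a ∈ expDegreeLT φ n ↔ ∀ m, n ≤ m → (φ a).coeff m = 0 := by
  simp [expDegreeLT, mem_degreeLT, degree_lt_iff_coeff_zero]

namespace IsExpMap

theorem injective (hφ : IsExpMap φ) : Function.Injective φ := fun a b h => by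
  rw [← hφ.1 a, h, hφ.1 b]

theorem coeff_mem_expInvariants (hφ : IsExpMap φ) {a : A} {n : ℕ} (h : (φ a).natDegree ≤ n) :
    (φ a).coeff n ∈ expInvariants φ := by
  have key := congrArg (coeff · n) (hφ.2 a)
  simp only [coeff_map] at key
  rw [eval₂_eq_sum_range' _ (Nat.lt_succ_of_le h), finsetSum_coeff,
    Finset.sum_eq_single_of_mem n (by simp)] at key
  · simpa [mem_expInvariants, coeff_X_add_C_pow] using key
  · intro i hi hin
    have : i < n := by simp at hi; omega
    simp [coeff_X_add_C_pow, Nat.choose_eq_zero_of_lt this]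

theorem natDegree_ne_zero (hφ : IsExpMap φ) {a : A} (ha : φ a ≠ C a) :
    (φ a).natDegree ≠ 0 := fun h => by
  obtain ⟨b, hb⟩ := natDegree_eq_zero.1 h
  have := hφ.1 a
  rw [← hb, eval_C] at this
  exact ha (by rw [← hb, this])

/-- The top coefficient on elements of bounded degree, as a linear map to the invariants. -/
noncomputable def topCoeff (hφ : IsExpMap φ) (n : ℕ) :
    expDegreeLT φ (n + 1) →ₗ[expInvariants φ] expInvariants φ where
  toFun a := ⟨(φ a).coeff n, hφ.coeff_mem_expInvariants
    (natDegree_le_iff_coeff_eq_zero.2 (mem_expDegreeLT.1 a.2))⟩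
  map_add' a b := by ext; simp
  map_smul' c a := by
    ext
    have : φ (c.1 * a) = C c.1 * φ a := by rw [map_mul, mem_expInvariants.1 c.2]
    simp [Subalgebra.smul_def, this]

theorem coe_topCoeff (hφ : IsExpMap φ) (n : ℕ) (a : expDegreeLT φ (n + 1)) :
    (hφ.topCoeff n a : A) = (φ a).coeff n := rfl

theorem coe_mem_expDegreeLT_of_mem_ker (hφ : IsExpMap φ) {n : ℕ} {a : expDegreeLT φ (n + 1)}
    (ha : a ∈ LinearMap.ker (hφ.topCoeff n)) : (a : A) ∈ expDegreeLT φ n := by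
  refine mem_expDegreeLT.2 fun m hm => ?_
  rcases hm.eq_or_lt with rfl | hm
  · rw [← hφ.coe_topCoeff, LinearMap.mem_ker.1 ha, ZeroMemClass.coe_zero]
  · exact mem_expDegreeLT.1 a.2 m hm

theorem rank_ker_topCoeff_le (hφ : IsExpMap φ) (n : ℕ) :
    Module.rank (expInvariants φ) (LinearMap.ker (hφ.topCoeff n)) ≤
      Module.rank (expInvariants φ) (expDegreeLT φ n) := by
  have hle : (LinearMap.ker (hφ.topCoeff n)).map (expDegreeLT φ (n + 1)).subtype ≤
      expDegreeLT φ n := by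
    rintro _ ⟨a, ha, rfl⟩
    exact hφ.coe_mem_expDegreeLT_of_mem_ker ha
  rw [(Submodule.equivMapOfInjective _ (Submodule.injective_subtype _) _).rank_eq]
  exact Submodule.rank_mono hle

end IsExpMap

end

theorem Transcendental.linearIndependent_pow {R S : Type*} [CommRing R] [CommRing S] [Algebra R S]
    {x : S} (hx : Transcendental R x) : LinearIndependent R (fun i : ℕ => x ^ i) := by
  have := (basisMonomials R).linearIndependent.map' (Polynomial.aeval x).toLinearMap
    (LinearMap.ker_eq_bot.2 (transcendental_iff_injective.1 hx))
  simpa [Function.comp_def] using this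

namespace IsExpMap

variable {k A : Type*} [Field k] [CommRing A] [IsDomain A] [Algebra k A] {φ : A →ₐ[k] A[X]}

theorem rank_expDegreeLT_le (hφ : IsExpMap φ) (n : ℕ) :
    Module.rank (expInvariants φ) (expDegreeLT φ n) ≤ n := by
  induction n with
  | zero =>
    have : expDegreeLT φ 0 = ⊥ := by
      refine (Submodule.eq_bot_iff _).2 fun a ha => ?_
      exact hφ.injective (by ext i; simpa using mem_expDegreeLT.1 ha i)
    rw [this, rank_bot, Nat.cast_zero]
  | succ n ih =>
    have hrange : Module.rank (expInvariants φ) (LinearMap.range (hφ.topCoeff n)) ≤ 1 :=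
      (Submodule.rank_le _).trans (CommSemiring.rank_self _).le
    rw [← LinearMap.rank_range_add_rank_ker (hφ.topCoeff n), Nat.cast_succ, add_comm]
    exact add_le_add ((hφ.rank_ker_topCoeff_le n).trans ih) hrange

theorem transcendental (hφ : IsExpMap φ) {x : A} (hx : φ x ≠ C x) :
    Transcendental (expInvariants φ) x := by
  have h : Transcendental A (φ x) := by
    have := (transcendental_X A).aeval (φ x) (hφ.natDegree_ne_zero hx)
      (mem_nonZeroDivisors_of_ne_zero (leadingCoeff_ne_zero.2 fun h =>
        hφ.natDegree_ne_zero hx (by simp [h])))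
    simpa using this
  have h' : Transcendental (expInvariants φ) (expInvariantsAlgHom φ x) :=
    h.restrictScalars Subtype.val_injective
  exact fun halg => h' (halg.algHom (expInvariantsAlgHom φ))

theorem isAlgebraic_adjoin (hφ : IsExpMap φ) {x : A} (hx : φ x ≠ C x) :
    Algebra.IsAlgebraic (Algebra.adjoin (expInvariants φ) {x}) A := by
  refine ⟨fun a => by_contra fun ha => ?_⟩
  have hxi : LinearIndependent (expInvariants φ) (fun i : ℕ =>
      (⟨x, Algebra.self_mem_adjoin_singleton _ x⟩ :
        Algebra.adjoin (expInvariants φ) {x}) ^ i) :=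
    .of_comp (Algebra.adjoin (expInvariants φ) {x}).val.toLinearMap
      (hφ.transcendental hx).linearIndependent_pow
  have hli := linearIndependent_smul hxi (Transcendental.linearIndependent_pow ha)
  set d := (φ x).natDegree + (φ a).natDegree with hd
  set N := d + 2
  have hmem (p : Fin N × Fin N) : x ^ (p.1 : ℕ) * a ^ (p.2 : ℕ) ∈ expDegreeLT φ (N * d + 1) := by
    refine mem_expDegreeLT.2 fun m hm => coeff_eq_zero_of_natDegree_lt (lt_of_lt_of_le ?_ hm)
    rw [map_mul, map_pow, map_pow]
    refine Nat.lt_succ_of_le (natDegree_mul_le.trans ?_)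
    have h₁ := natDegree_pow_le_of_le (p.1 : ℕ) (le_refl (φ x).natDegree)
    have h₂ := natDegree_pow_le_of_le (p.2 : ℕ) (le_refl (φ a).natDegree)
    have h₃ := Nat.mul_le_mul_right (φ x).natDegree p.1.2.le
    have h₄ := Nat.mul_le_mul_right (φ a).natDegree p.2.2.le
    rw [hd, mul_add]
    omega
  have hli' : LinearIndependent (expInvariants φ) (fun p : Fin N × Fin N =>
      (⟨x ^ (p.1 : ℕ) * a ^ (p.2 : ℕ), hmem p⟩ : expDegreeLT φ (N * d + 1))) := by
    refine .of_comp (Submodule.subtype _) ?_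
    exact hli.comp (fun p : Fin N × Fin N => ((p.1 : ℕ), (p.2 : ℕ))) fun p q h => by
      simpa [Prod.ext_iff, Fin.ext_iff] using h
  have hcard := hli'.cardinal_lift_le_rank.trans
    (Cardinal.lift_le.2 (hφ.rank_expDegreeLT_le (N * d + 1)))
  have : N * N ≤ N * d + 1 := by
    simp only [Cardinal.mk_fintype, Fintype.card_prod, Fintype.card_fin,
      Cardinal.lift_natCast] at hcard
    exact_mod_cast hcard
  simp only [N] at this
  nlinarith

theorem isTranscendenceBasis (hφ : IsExpMap φ) {x : A} (hx : φ x ≠ C x) :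
    IsTranscendenceBasis (expInvariants φ) (fun _ : Unit => x) := by
  rw [isTranscendenceBasis_iff_algebraicIndependent_isAlgebraic, Set.range_const]
  exact ⟨algebraicIndependent_unique_type_iff.2 (hφ.transcendental hx), hφ.isAlgebraic_adjoin hx⟩

end IsExpMap

/-- If `A` is a domain of finite transcendence degree over `k` and `φ` is a
nontrivial exponential map on `A`, then `trdeg_k(A^φ) = trdeg_k(A) - 1`
(expressed via transcendence bases: `#t + 1 = #s`). -/
theorem stmt_9 {k A : Type*} [Field k] [CommRing A] [IsDomain A] [Algebra k A]
    (φ : A →ₐ[k] Polynomial A) (hφ : IsExpMap φ)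
    (hnontriv : ∃ a : A, φ a ≠ Polynomial.C a)
    (s : Set A) (hs : IsTranscendenceBasis k ((↑) : s → A)) (hfin : s.Finite)
    (t : Set (expInvariants φ))
    (ht : IsTranscendenceBasis k ((↑) : t → expInvariants φ)) :
    Cardinal.mk t + 1 = Cardinal.mk s := by
  obtain ⟨x, hx⟩ := hnontriv
  have h := hs.lift_cardinalMk_eq
    (ht.sumElim_comp (hφ.isTranscendenceBasis hx))
  simpa [add_comm] using h.symm
end

section
/- Let k be a field, n ≥ 2, h ∈ k[X] with h(0) ≠ 0, and R = k[X,Y,Z]/(XⁿY - Z² - h(X)Z). Then for every nontrivial exponential map φ on R, the ring of invariants R^φ equals k[x], and consequently AK(R) = k[x], the subalgebra generated by x. -/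
noncomputable section

/-- The defining relation `XⁿY - Z² - h(X)Z` in `k[X,Y,Z]` (variables `X 0, X 1, X 2`). -/
def danRel (k : Type*) [Field k] (n : ℕ) (h : Polynomial k) : MvPolynomial (Fin 3) k :=
  MvPolynomial.X 0 ^ n * MvPolynomial.X 1 - MvPolynomial.X 2 ^ 2
    - Polynomial.aeval (MvPolynomial.X 0 : MvPolynomial (Fin 3) k) h * MvPolynomial.X 2

/-- The coordinate ring `R = k[X,Y,Z]/(XⁿY - Z² - h(X)Z)` of a Danielewski surface. -/
abbrev DanRing (k : Type*) [Field k] (n : ℕ) (h : Polynomial k) : Type _ :=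
  MvPolynomial (Fin 3) k ⧸ Ideal.span {danRel k n h}

/-- The image `x` of `X` in `R`. -/
def dx (k : Type*) [Field k] (n : ℕ) (h : Polynomial k) : DanRing k n h :=
  Ideal.Quotient.mk _ (MvPolynomial.X 0)

/-- The image `y` of `Y` in `R`. -/
def dy (k : Type*) [Field k] (n : ℕ) (h : Polynomial k) : DanRing k n h :=
  Ideal.Quotient.mk _ (MvPolynomial.X 1)

/-- The image `z` of `Z` in `R`. -/
def dz (k : Type*) [Field k] (n : ℕ) (h : Polynomial k) : DanRing k n h :=
  Ideal.Quotient.mk _ (MvPolynomial.X 2)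

open Polynomial

section HasLead

variable {Γ K : Type*} [LinearOrder Γ] [CommRing K]

/-- The Hahn series `f` is supported in degrees `≥ γ` and its coefficient at `γ` is `c`,
which is allowed to vanish. -/
def HasLead (f : HahnSeries Γ K) (γ : Γ) (c : K) : Prop :=
  f.coeff γ = c ∧ ∀ γ' < γ, f.coeff γ' = 0

namespace HasLead

variable {f g : HahnSeries Γ K} {γ δ : Γ} {c d : K}

theorem unique (hf : HasLead f γ c) (hf' : HasLead f γ d) : c = d :=
  hf.1.symm.trans hf'.1

theorem zero (γ : Γ) : HasLead (0 : HahnSeries Γ K) γ 0 := by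
  simp [HasLead]

theorem add (hf : HasLead f γ c) (hg : HasLead g γ d) : HasLead (f + g) γ (c + d) :=
  ⟨by simp [hf.1, hg.1], fun γ' hγ' => by simp [hf.2 γ' hγ', hg.2 γ' hγ']⟩

theorem sum {ι : Type*} {s : Finset ι} {f : ι → HahnSeries Γ K} {c : ι → K}
    (hf : ∀ i ∈ s, HasLead (f i) γ (c i)) : HasLead (∑ i ∈ s, f i) γ (∑ i ∈ s, c i) := by
  refine ⟨?_, fun γ' hγ' => ?_⟩
  · rw [HahnSeries.coeff_sum]
    exact Finset.sum_congr rfl fun i hi => (hf i hi).1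
  · rw [HahnSeries.coeff_sum]
    exact Finset.sum_eq_zero fun i hi => (hf i hi).2 γ' hγ'

theorem lower (hf : HasLead f γ c) (h : δ < γ) : HasLead f δ 0 :=
  ⟨hf.2 δ h, fun γ' hγ' => hf.2 γ' (hγ'.trans h)⟩

theorem lower_le (hf : HasLead f γ c) (h : δ ≤ γ) :
    HasLead f δ (if δ = γ then c else 0) := by
  split_ifs with h'
  · exact h' ▸ hf
  · exact hf.lower (lt_of_le_of_ne h h')

theorem single (γ : Γ) (c : K) : HasLead (HahnSeries.single γ c) γ c :=
  ⟨by simp, fun _ h => HahnSeries.coeff_single_of_ne h.ne⟩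

variable [AddCommGroup Γ]

theorem one : HasLead (1 : HahnSeries Γ K) 0 1 := single 0 1

variable [IsOrderedAddMonoid Γ]

theorem mul (hf : HasLead f γ c) (hg : HasLead g δ d) : HasLead (f * g) (γ + δ) (c * d) := by
  have key : ∀ a b, a + b ≤ γ + δ → (a, b) ≠ (γ, δ) → f.coeff a * g.coeff b = 0 := by
    intro a b hab hne
    rcases lt_or_ge a γ with ha | ha
    · rw [hf.2 a ha, zero_mul]
    · have hb : b < δ := by
        rcases ha.eq_or_lt with rfl | ha
        · exact lt_of_le_of_ne (le_of_add_le_add_left hab) fun hb => hne (by rw [hb])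
        · by_contra! hb
          exact absurd hab (not_le.2 (add_lt_add_of_lt_of_le ha hb))
      rw [hg.2 b hb, mul_zero]
  refine ⟨?_, fun γ' hγ' => ?_⟩
  · rw [HahnSeries.coeff_mul, Finset.sum_eq_single (γ, δ), hf.1, hg.1]
    · rintro ⟨a, b⟩ hab hne
      exact key a b (by simpa using (Finset.mem_antidiagonal.1 hab).2.2.le) hne
    · intro hn
      by_contra hne
      apply hn
      simp only [Finset.mem_antidiagonal, HahnSeries.mem_support, and_true]
      exact ⟨left_ne_zero_of_mul hne, right_ne_zero_of_mul hne⟩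
  · rw [HahnSeries.coeff_mul]
    refine Finset.sum_eq_zero ?_
    rintro ⟨a, b⟩ hab
    have hab' : a + b = γ' := by simpa using (Finset.mem_antidiagonal.1 hab).2.2
    refine key a b (hab'.trans_lt hγ').le ?_
    rintro ⟨⟩
    exact hγ'.ne hab'.symm

theorem pow (hf : HasLead f γ c) (n : ℕ) : HasLead (f ^ n) (n • γ) (c ^ n) := by
  induction n with
  | zero => simpa using one
  | succ n ih => simpa [pow_succ, succ_nsmul] using ih.mul hf

theorem algebraMap_mul {k : Type*} [CommRing k] [Algebra k K] (a : k) (hf : HasLead f γ c) :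
    HasLead (algebraMap k (HahnSeries Γ K) a * f) γ (algebraMap k K a * c) := by
  rw [HahnSeries.algebraMap_apply]
  simpa using (single (0 : Γ) (algebraMap k K a)).mul hf

end HasLead

end HasLead

section DanRing

variable (k : Type*) [Field k] (n : ℕ) (h : k[X])

theorem danRing_relation :
    dx k n h ^ n * dy k n h = dz k n h ^ 2 + aeval (dx k n h) h * dz k n h := by
  have key : Ideal.Quotient.mk (Ideal.span {danRel k n h})
      (MvPolynomial.X 0 ^ n * MvPolynomial.X 1 - MvPolynomial.X 2 ^ 2
        - aeval (MvPolynomial.X 0 : MvPolynomial (Fin 3) k) h * MvPolynomial.X 2) = 0 :=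
    Ideal.Quotient.eq_zero_iff_mem.2 (Ideal.mem_span_singleton_self _)
  have haeval : Ideal.Quotient.mk (Ideal.span {danRel k n h})
      (aeval (MvPolynomial.X 0 : MvPolynomial (Fin 3) k) h) = aeval (dx k n h) h := by
    rw [← Ideal.Quotient.mkₐ_eq_mk k, ← aeval_algHom_apply]
    rfl
  rw [map_sub, map_sub, map_mul, map_mul, map_pow, map_pow, haeval] at key
  change dx k n h ^ n * dy k n h - dz k n h ^ 2 - aeval (dx k n h) h * dz k n h = 0 at key
  linear_combination key

variable {k n h}

section Lift

variable {S : Type*} [CommRing S] [Algebra k S]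

/-- The homomorphism out of `R` given by a solution of the defining equation. -/
def danLift {a b c : S} (habc : a ^ n * b = c ^ 2 + aeval a h * c) : DanRing k n h →ₐ[k] S :=
  Ideal.Quotient.liftₐ _ (MvPolynomial.aeval ![a, b, c]) (by
    intro p hp
    refine Submodule.span_induction (p := fun p _ => MvPolynomial.aeval ![a, b, c] p = 0)
      ?_ (map_zero _) ?_ ?_ hp
    · rintro _ rfl
      simp only [danRel, map_sub, map_mul, map_pow, MvPolynomial.aeval_X, ← aeval_algHom_apply]
      simp [habc]
    · intro p q _ _ hp hq
      rw [map_add, hp, hq, add_zero]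
    · intro p q _ hq
      rw [smul_eq_mul, map_mul, hq, mul_zero])

variable {a b c : S} (habc : a ^ n * b = c ^ 2 + aeval a h * c)

@[simp] theorem danLift_dx : danLift habc (dx k n h) = a := by
  change MvPolynomial.aeval ![a, b, c] (MvPolynomial.X 0) = a
  simp

@[simp] theorem danLift_dy : danLift habc (dy k n h) = b := by
  change MvPolynomial.aeval ![a, b, c] (MvPolynomial.X 1) = b
  simp

@[simp] theorem danLift_dz : danLift habc (dz k n h) = c := by
  change MvPolynomial.aeval ![a, b, c] (MvPolynomial.X 2) = c
  simp

theorem danRing_algHom_ext {S : Type*} [Semiring S] [Algebra k S] {f g : DanRing k n h →ₐ[k] S}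
    (hx : f (dx k n h) = g (dx k n h)) (hy : f (dy k n h) = g (dy k n h))
    (hz : f (dz k n h) = g (dz k n h)) : f = g := by
  refine Ideal.Quotient.algHom_ext _ (MvPolynomial.algHom_ext fun i => ?_)
  fin_cases i
  exacts [hx, hy, hz]

end Lift

/-- The monomial `xⁱ yʲ zᵉ` of `R`, for `e ∈ {0, 1}`. -/
def danMon (k : Type*) [Field k] (n : ℕ) (h : k[X]) (m : ℕ × ℕ × Fin 2) : DanRing k n h :=
  dx k n h ^ m.1 * dy k n h ^ m.2.1 * dz k n h ^ (m.2.2 : ℕ)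

theorem span_range_danMon : Submodule.span k (Set.range (danMon k n h)) = ⊤ := by
  set V := Submodule.span k (Set.range (danMon k n h)) with hV
  have hmem : ∀ m, danMon k n h m ∈ V := fun m => Submodule.subset_span ⟨m, rfl⟩
  have mul_mem : ∀ b : DanRing k n h, (∀ m, b * danMon k n h m ∈ V) → ∀ a ∈ V, b * a ∈ V := by
    intro b hb a ha
    refine Submodule.span_induction (p := fun a _ => b * a ∈ V) ?_ (by simp) ?_ ?_ ha
    · rintro _ ⟨m, rfl⟩
      exact hb m
    · intro p q _ _ hp hq
      rw [mul_add]
      exact V.add_mem hp hq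
    · intro c p _ hp
      rw [mul_smul_comm]
      exact V.smul_mem c hp
  have x_mul : ∀ a ∈ V, dx k n h * a ∈ V := mul_mem _ fun ⟨i, j, e⟩ => by
    convert hmem (i + 1, j, e) using 1
    simp only [danMon]
    ring
  have y_mul : ∀ a ∈ V, dy k n h * a ∈ V := mul_mem _ fun ⟨i, j, e⟩ => by
    convert hmem (i, j + 1, e) using 1
    simp only [danMon]
    ring
  have xpow_mul : ∀ (i : ℕ), ∀ a ∈ V, dx k n h ^ i * a ∈ V := by
    intro i
    induction i with
    | zero => simp
    | succ i ih =>
      intro a ha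
      rw [pow_succ, mul_assoc]
      exact ih _ (x_mul a ha)
  have poly_mul : ∀ (p : k[X]), ∀ a ∈ V, aeval (dx k n h) p * a ∈ V := by
    intro p a ha
    rw [aeval_eq_sum_range, Finset.sum_mul]
    refine V.sum_mem fun i _ => ?_
    rw [smul_mul_assoc]
    exact V.smul_mem _ (xpow_mul i a ha)
  have z_mul : ∀ a ∈ V, dz k n h * a ∈ V := mul_mem _ fun ⟨i, j, e⟩ => by
    fin_cases e
    · convert hmem (i, j, 1) using 1
      simp only [danMon]
      simp
      ring
    · have : dz k n h * danMon k n h (i, j, 1) =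
          danMon k n h (i + n, j + 1, 0) - aeval (dx k n h) h * danMon k n h (i, j, 1) := by
        simp only [danMon, Fin.val_one, Fin.val_zero]
        linear_combination
          -(dx k n h ^ i * dy k n h ^ j) * danRing_relation k n h
      exact this ▸ V.sub_mem (hmem _) (poly_mul _ _ (hmem _))
  refine eq_top_iff.2 fun a _ => ?_
  obtain ⟨p, rfl⟩ := Ideal.Quotient.mk_surjective a
  induction p using MvPolynomial.induction_on with
  | C c =>
    have : Ideal.Quotient.mk (Ideal.span {danRel k n h}) (MvPolynomial.C c) =
        c • danMon k n h (0, 0, 0) := by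
      simp only [danMon, Fin.val_zero, pow_zero, mul_one, MvPolynomial.C_eq_smul_one]
      rfl
    exact this ▸ V.smul_mem c (hmem _)
  | add p q hp hq =>
    rw [map_add]
    exact V.add_mem (hp trivial) (hq trivial)
  | mul_X p i hp =>
    rw [map_mul, mul_comm]
    fin_cases i
    exacts [x_mul _ (hp trivial), y_mul _ (hp trivial), z_mul _ (hp trivial)]

/-- The degree of `xⁱ yʲ zᵉ`, for the lexicographic order which puts high powers of `z` first and
then low powers of `x`, and for which `x ^ n * y` and `z ^ 2` have the same degree. -/
def danDeg (n : ℕ) (m : ℕ × ℕ × Fin 2) : ℚ ×ₗ ℚ :=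
  toLex (-(2 * m.2.1 + (m.2.2 : ℕ)), m.1 - n * m.2.1)

theorem danDeg_injective (n : ℕ) : Function.Injective (danDeg n) := by
  rintro ⟨i, j, e⟩ ⟨i', j', e'⟩ heq
  have heq' := ofLex.injective.eq_iff.2 heq
  simp only [danDeg, ofLex_toLex, Prod.mk.injEq, neg_inj] at heq'
  obtain ⟨h1, h2⟩ := heq'
  have h1' : 2 * j + (e : ℕ) = 2 * j' + (e' : ℕ) := by exact_mod_cast h1
  have hj : j = j' := by omega
  have he : e = e' := by omega
  subst hj he
  have hi : (i : ℚ) = i' := by linarith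
  simpa using hi

/-- `r` is `c` times the monomial of index `m` plus terms of strictly larger degree. -/
def IsLeadTerm (r : DanRing k n h) (m : ℕ × ℕ × Fin 2) (c : k) : Prop :=
  ∃ l : (ℕ × ℕ × Fin 2) →₀ k, Finsupp.linearCombination k (danMon k n h) l = r ∧
    l m = c ∧ ∀ m' ∈ l.support, danDeg n m ≤ danDeg n m'

theorem exists_isLeadTerm {r : DanRing k n h} (hr : r ≠ 0) :
    ∃ m, ∃ c ≠ 0, IsLeadTerm r m c := by
  have hmem : r ∈ Submodule.span k (Set.range (danMon k n h)) :=
    span_range_danMon (k := k) (n := n) (h := h) ▸ Submodule.mem_top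
  obtain ⟨l, rfl⟩ := (Finsupp.mem_span_range_iff_exists_finsupp).1 hmem
  have hl : l.support.Nonempty := by
    rw [Finsupp.support_nonempty_iff]
    rintro rfl
    simp at hr
  obtain ⟨m, hm, hmin⟩ := l.support.exists_min_image (danDeg n) hl
  exact ⟨m, l m, Finsupp.mem_support_iff.1 hm, l, rfl, rfl, hmin⟩

theorem isLeadTerm_danMon (m : ℕ × ℕ × Fin 2) : IsLeadTerm (danMon k n h m) m 1 := by
  refine ⟨Finsupp.single m 1, by simp, by simp, fun m' hm' => ?_⟩
  have : m' = m := by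
    simpa [eq_comm] using Finsupp.support_single_subset hm'
  rw [this]

theorem IsLeadTerm.mem_adjoin {r : DanRing k n h} {i : ℕ} {c : k}
    (hr : IsLeadTerm r (i, 0, 0) c) : r ∈ Algebra.adjoin k {dx k n h} := by
  obtain ⟨l, rfl, -, hl⟩ := hr
  rw [Finsupp.linearCombination_apply]
  refine Subalgebra.sum_mem _ fun m hm => Subalgebra.smul_mem _ ?_ _
  obtain ⟨i', j, e⟩ := m
  have hle := hl _ hm
  simp only [danDeg, Prod.Lex.toLex_le_toLex, Fin.val_zero] at hle
  have hje : 2 * j + (e : ℕ) = 0 := by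
    rcases hle with hle | ⟨hle, -⟩
    · have h0 : (0 : ℚ) ≤ 2 * j + (e : ℕ) := by positivity
      norm_num at hle
      linarith
    · norm_num at hle
      exact_mod_cast (by linarith : (2 * j + (e : ℕ) : ℚ) = 0)
  have hj : j = 0 := by omega
  have he : e = 0 := by omega
  subst hj he
  simpa [danMon] using Subalgebra.pow_mem _ (Algebra.self_mem_adjoin_singleton k (dx k n h)) i'

end DanRing

section Embedding

variable {k : Type*} [Field k] {n : ℕ} {h : k[X]}

theorem danDeg_eq (m : ℕ × ℕ × Fin 2) : danDeg n m =
    m.1 • danDeg n (1, 0, 0) + m.2.1 • danDeg n (0, 1, 0) + (m.2.2 : ℕ) • danDeg n (0, 0, 1) := by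
  apply ofLex.injective
  ext <;> simp [danDeg] <;> ring

section Hom

variable {F : DanRing k n h →ₐ[k] HahnSeries (ℚ ×ₗ ℚ) k[X]} {α β γ : k[X]}

theorem hasLead_danMon (hx : HasLead (F (dx k n h)) (danDeg n (1, 0, 0)) α)
    (hy : HasLead (F (dy k n h)) (danDeg n (0, 1, 0)) γ)
    (hz : HasLead (F (dz k n h)) (danDeg n (0, 0, 1)) β) (m : ℕ × ℕ × Fin 2) :
    HasLead (F (danMon k n h m)) (danDeg n m) (α ^ m.1 * γ ^ m.2.1 * β ^ (m.2.2 : ℕ)) := by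
  rw [danDeg_eq m, danMon, map_mul, map_mul, map_pow, map_pow, map_pow]
  exact ((hx.pow _).mul (hy.pow _)).mul (hz.pow _)

theorem IsLeadTerm.hasLead (hx : HasLead (F (dx k n h)) (danDeg n (1, 0, 0)) α)
    (hy : HasLead (F (dy k n h)) (danDeg n (0, 1, 0)) γ)
    (hz : HasLead (F (dz k n h)) (danDeg n (0, 0, 1)) β) {r : DanRing k n h}
    {m : ℕ × ℕ × Fin 2} {c : k} (hr : IsLeadTerm r m c) :
    HasLead (F r) (danDeg n m) (C c * (α ^ m.1 * γ ^ m.2.1 * β ^ (m.2.2 : ℕ))) := by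
  obtain ⟨l, rfl, rfl, hl⟩ := hr
  have hsum : F (Finsupp.linearCombination k (danMon k n h) l) =
      ∑ m' ∈ l.support, algebraMap k (HahnSeries (ℚ ×ₗ ℚ) k[X]) (l m') * F (danMon k n h m') := by
    rw [Finsupp.linearCombination_apply, Finsupp.sum, map_sum]
    refine Finset.sum_congr rfl fun m' _ => ?_
    rw [← Algebra.smul_def]
    exact map_smul F _ _
  have hcoeff : C (l m) * (α ^ m.1 * γ ^ m.2.1 * β ^ (m.2.2 : ℕ)) = ∑ m' ∈ l.support,
      if danDeg n m = danDeg n m' then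
        algebraMap k k[X] (l m') * (α ^ m'.1 * γ ^ m'.2.1 * β ^ (m'.2.2 : ℕ)) else 0 := by
    simp only [(danDeg_injective n).eq_iff, Finset.sum_ite_eq]
    split_ifs with hm
    · rfl
    · rw [Finsupp.notMem_support_iff.1 hm, map_zero, zero_mul]
  rw [hsum, hcoeff]
  exact HasLead.sum fun m' hm' =>
    ((hasLead_danMon hx hy hz m').algebraMap_mul (l m')).lower_le (hl m' hm')

theorem exists_hasLead_aeval {f : HahnSeries (ℚ ×ₗ ℚ) k[X]}
    (hf : HasLead f (danDeg n (1, 0, 0)) α) (p : k[X]) : ∃ c, HasLead (aeval f p) 0 c := by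
  have hnonneg : ∀ i : ℕ, 0 ≤ i • danDeg n (1, 0, 0) := fun i =>
    nsmul_nonneg (Prod.Lex.le_iff.2 (by simp [danDeg])) i
  simp_rw [aeval_eq_sum_range, Algebra.smul_def]
  exact ⟨_, HasLead.sum fun i _ => ((hf.pow i).algebraMap_mul _).lower_le (hnonneg i)⟩

theorem hasLead_relation {f g : HahnSeries (ℚ ×ₗ ℚ) k[X]}
    (hf : HasLead f (danDeg n (1, 0, 0)) α) (hg : HasLead g (danDeg n (0, 0, 1)) β) :
    HasLead (g ^ 2 + aeval f h * g) (2 • danDeg n (0, 0, 1)) (β ^ 2) := by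
  obtain ⟨c, hc⟩ := exists_hasLead_aeval hf h
  have hlt : 2 • danDeg n (0, 0, 1) < 0 + danDeg n (0, 0, 1) :=
    Prod.Lex.lt_iff.2 (by simp [danDeg])
  simpa using (hg.pow 2).add ((hc.mul hg).lower hlt)

theorem nsmul_danDeg_add :
    n • danDeg n (1, 0, 0) + danDeg n (0, 1, 0) = 2 • danDeg n (0, 0, 1) := by
  apply ofLex.injective
  ext <;> simp [danDeg]

theorem lead_pow_mul_eq (hx : HasLead (F (dx k n h)) (danDeg n (1, 0, 0)) α)
    (hy : HasLead (F (dy k n h)) (danDeg n (0, 1, 0)) γ)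
    (hz : HasLead (F (dz k n h)) (danDeg n (0, 0, 1)) β) : α ^ n * γ = β ^ 2 := by
  have key := congrArg F (danRing_relation k n h)
  rw [map_add, map_mul, map_mul, map_pow, map_pow, ← aeval_algHom_apply] at key
  have := (hx.pow n).mul hy
  rw [key, nsmul_danDeg_add] at this
  exact this.unique (hasLead_relation hx hz)

end Hom

variable (k n h)

/-- The embedding of `R` in a ring of Hahn series, which sends `x` and `z` to monomials. -/
def danEmb : DanRing k n h →ₐ[k] HahnSeries (ℚ ×ₗ ℚ) k[X] :=
  danLift (a := HahnSeries.single (danDeg n (1, 0, 0)) 1)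
    (c := HahnSeries.single (danDeg n (0, 0, 1)) 1)
    (b := HahnSeries.single (-(n • danDeg n (1, 0, 0))) 1 *
      (HahnSeries.single (danDeg n (0, 0, 1)) 1 ^ 2 +
        aeval (HahnSeries.single (danDeg n (1, 0, 0)) 1) h *
          HahnSeries.single (danDeg n (0, 0, 1)) 1)) (by
    rw [← mul_assoc, HahnSeries.single_pow, HahnSeries.single_mul_single]
    simp)

theorem hasLead_danEmb_dx : HasLead (danEmb k n h (dx k n h)) (danDeg n (1, 0, 0)) 1 := by
  rw [danEmb, danLift_dx]
  exact .single _ _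

theorem hasLead_danEmb_dz : HasLead (danEmb k n h (dz k n h)) (danDeg n (0, 0, 1)) 1 := by
  rw [danEmb, danLift_dz]
  exact .single _ _

theorem hasLead_danEmb_dy : HasLead (danEmb k n h (dy k n h)) (danDeg n (0, 1, 0)) 1 := by
  rw [danEmb, danLift_dy, show danDeg n (0, 1, 0) =
    -(n • danDeg n (1, 0, 0)) + 2 • danDeg n (0, 0, 1) by rw [← nsmul_danDeg_add]; abel]
  simpa using (HasLead.single (-(n • danDeg n (1, 0, 0))) (1 : k[X])).mul
    (hasLead_relation (h := h) (HasLead.single (danDeg n (1, 0, 0)) (1 : k[X]))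
      (HasLead.single (danDeg n (0, 0, 1)) (1 : k[X])))

variable {k n h}

theorem IsLeadTerm.hasLead_danEmb {r : DanRing k n h} {m : ℕ × ℕ × Fin 2} {c : k}
    (hr : IsLeadTerm r m c) : HasLead (danEmb k n h r) (danDeg n m) (C c) := by
  simpa using hr.hasLead (hasLead_danEmb_dx k n h) (hasLead_danEmb_dy k n h)
    (hasLead_danEmb_dz k n h)

theorem IsLeadTerm.ne_zero {r : DanRing k n h} {m : ℕ × ℕ × Fin 2} {c : k} (hc : c ≠ 0)
    (hr : IsLeadTerm r m c) : r ≠ 0 := by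
  rintro rfl
  have := hr.hasLead_danEmb
  rw [map_zero] at this
  exact hc (C_eq_zero.1 (this.unique (.zero _)))

theorem danEmb_injective : Function.Injective (danEmb k n h) := by
  rw [injective_iff_map_eq_zero]
  intro r hr
  by_contra hr0
  obtain ⟨m, c, hc, hm⟩ := exists_isLeadTerm hr0
  have := hm.hasLead_danEmb
  rw [hr] at this
  exact hc (C_eq_zero.1 (this.unique (.zero _)))

instance : IsDomain (DanRing k n h) :=
  (danEmb_injective (k := k) (n := n) (h := h)).isDomain

theorem linearIndependent_danMon : LinearIndependent k (danMon k n h) := by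
  rw [linearIndependent_iff]
  intro l hl
  by_contra hl0
  obtain ⟨m, hm, hmin⟩ :=
    l.support.exists_min_image (danDeg n) (Finsupp.support_nonempty_iff.2 hl0)
  exact IsLeadTerm.ne_zero (Finsupp.mem_support_iff.1 hm) ⟨l, rfl, rfl, hmin⟩ hl

end Embedding

section ExpMap

variable {k A : Type*} [Field k] [CommRing A] [Algebra k A] {φ : A →ₐ[k] A[X]}

theorem IsExpMap.coeff_zero (hφ : IsExpMap φ) (a : A) : (φ a).coeff 0 = a := by
  rw [coeff_zero_eq_eval_zero, hφ.1]

theorem IsExpMap.coeff_coeff (hφ : IsExpMap φ) (a : A) (p i : ℕ) :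
    (φ ((φ a).coeff p)).coeff i = (i + p).choose p * (φ a).coeff (i + p) := by
  have key := congrArg (fun q => (q.coeff p).coeff i) (hφ.2 a)
  simp only [coeff_map, eval₂_eq_sum_range, finsetSum_coeff, RingHom.comp_apply, coeff_C_mul,
    coeff_X_add_C_pow] at key
  refine key.trans ?_
  have hterm : ∀ j, (φ a).coeff j * (X ^ (j - p) * (j.choose p : A[X])).coeff i =
      if j = i + p then (i + p).choose p * (φ a).coeff (i + p) else 0 := by
    intro j
    rw [← C_eq_natCast, coeff_mul_C, coeff_X_pow]
    rcases lt_or_ge j p with hj | hj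
    · simp [Nat.choose_eq_zero_of_lt hj, show j ≠ i + p by omega]
    · by_cases hji : j = i + p
      · subst hji
        simp [mul_comm]
      · simp [hji, show i ≠ j - p by omega]
  simp_rw [hterm, Finset.sum_ite_eq']
  split_ifs with hmem
  · rfl
  · rw [coeff_eq_zero_of_natDegree_lt (by simpa using hmem), mul_zero]

theorem IsExpMap.map_leadingCoeff (hφ : IsExpMap φ) (a : A) :
    φ (φ a).leadingCoeff = C (φ a).leadingCoeff := by
  ext i
  rw [leadingCoeff, hφ.coeff_coeff, coeff_C]
  split_ifs with hi
  · simp [hi]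
  · rw [coeff_eq_zero_of_natDegree_lt (by omega), mul_zero]

theorem IsExpMap.ne_zero (hφ : IsExpMap φ) {a : A} (ha : a ≠ 0) : φ a ≠ 0 := by
  intro h
  apply ha
  rw [← hφ.1 a, h, eval_zero]

theorem IsExpMap.injective_map_comp [Nontrivial A] (hφ : IsExpMap φ) (ε : A →ₐ[k] k)
    (hinv : ∀ a, φ a = C a → a ∈ Set.range (algebraMap k A)) :
    Function.Injective ((mapAlgHom ε).comp φ) := by
  rw [injective_iff_map_eq_zero]
  intro a ha
  by_contra ha0
  obtain ⟨c, hc⟩ := hinv _ (hφ.map_leadingCoeff a)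
  have hcoeff : ε ((φ a).leadingCoeff) = 0 := by
    have := congrArg (fun q => q.coeff (φ a).natDegree) ha
    simpa using this
  rw [← hc, AlgHom.commutes, Algebra.algebraMap_self_apply] at hcoeff
  rw [hcoeff, map_zero, eq_comm, leadingCoeff_eq_zero] at hc
  exact hφ.ne_zero ha0 hc

theorem IsExpMap.eq_C_of_aeval [IsDomain A] {x : A} (hx : φ x ≠ C x) (hφ : IsExpMap φ) {p : k[X]}
    (hp : φ (aeval x p) = C (aeval x p)) : p.natDegree = 0 := by
  have hdeg : (φ x).natDegree ≠ 0 := by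
    intro hdeg
    apply hx
    rw [eq_C_of_natDegree_eq_zero hdeg, hφ.coeff_zero]
  have hcomp : φ (aeval x p) = (p.map (algebraMap k A)).comp (φ x) := by
    rw [← aeval_algHom_apply, comp, eval₂_map, aeval_def]
    rfl
  have := natDegree_comp (p := p.map (algebraMap k A)) (q := φ x)
  rw [← hcomp, hp, natDegree_C, natDegree_map_eq_of_injective (algebraMap k A).injective] at this
  simpa [hdeg, eq_comm] using this

theorem isExpMap_of_adjoin_eq_top {s : Set A} (hs : Algebra.adjoin k s = ⊤)
    (h0 : ∀ a ∈ s, (φ a).eval 0 = a)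
    (h1 : ∀ a ∈ s, (φ a).map φ.toRingHom = eval₂ (C.comp C) (X + C X) (φ a)) : IsExpMap φ := by
  constructor
  · exact fun a => DFunLike.congr_fun (AlgHom.ext_of_adjoin_eq_top hs
      (φ₁ := ((aeval (0 : A)).restrictScalars k).comp φ) (φ₂ := AlgHom.id k A)
      fun a ha => by simpa [coe_aeval_eq_eval] using h0 a ha) a
  · exact fun a => DFunLike.congr_fun (AlgHom.ext_of_adjoin_eq_top hs
      (φ₁ := (mapAlgHom φ).comp φ)
      (φ₂ := (eval₂AlgHom (CAlgHom.comp CAlgHom) (X + C X) fun _ => Commute.all _ _).comp φ)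
      h1) a

theorem isExpMap_of_shear {x y z u w : A} (hA : Algebra.adjoin k {x, y, z} = ⊤)
    (hx : φ x = C x) (hu : φ u = C u) (hw : φ w = C w)
    (hy : φ y = C y + C (2 * z + w) * X + C u * X ^ 2) (hz : φ z = C z + C u * X) :
    IsExpMap φ := by
  have hcoe : ∀ a, φ.toRingHom a = φ a := fun _ => rfl
  refine isExpMap_of_adjoin_eq_top hA ?_ ?_
  · rintro a (rfl | rfl | rfl) <;> simp [hx, hy, hz]
  · rintro a (rfl | rfl | rfl)
    · simp [hx]
    · simp only [hy, Polynomial.map_add, Polynomial.map_mul, Polynomial.map_pow, map_C, map_X,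
        hcoe, map_add, map_mul, map_ofNat, Polynomial.map_ofNat, map_pow,
        hu, hw, hz, eval₂_add, eval₂_mul, eval₂_pow, eval₂_C,
        eval₂_X, eval₂_ofNat, RingHom.comp_apply]
      ring
    · simp only [hz, map_add, Polynomial.map_add, Polynomial.map_mul, map_C, map_X, hcoe, hu,
        map_mul, eval₂_add, eval₂_mul, eval₂_C, eval₂_X, RingHom.comp_apply]
      ring

end ExpMap

section Combinatorics

variable {k : Type*} [Field k] {α β γ : k[X]} {n : ℕ}

theorem pow_ne_sq_of_coeff_support {d : ℕ} (hd : d ≠ 0) (hn : Odd n) (hn1 : 1 < n)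
    (hα0 : α.coeff 0 = 1) (hαd : α.coeff (2 * d) ≠ 0)
    (hα : ∀ i, α.coeff i ≠ 0 → i = 0 ∨ i = 2 * d)
    (hβ0 : β.coeff 0 = 1) (hβ : ∀ i, β.coeff i ≠ 0 → i = 0 ∨ ∃ l, Odd l ∧ i = l * d) :
    α ^ n ≠ β ^ 2 := by
  intro hrel
  set c := α.coeff (2 * d) with hc
  have hα_eq : α = expand k (2 * d) (1 + C c * X) := by
    have : expand k (2 * d) (1 + C c * X) = C 1 + C c * X ^ (2 * d) := by simp
    rw [this]
    ext i
    rw [coeff_add, coeff_C, coeff_C_mul_X_pow]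
    by_cases h0 : i = 0
    · subst h0
      simp [hα0, hd]
    · by_cases h2 : i = 2 * d
      · subst h2
        simp [hd, hc]
      · rw [if_neg h0, if_neg h2, add_zero]
        by_contra hi
        exact (hα i hi).elim h0 h2
  have hpow : α ^ n = expand k (2 * d) (((1 + X) ^ n).comp (C c * X)) := by
    rw [hα_eq, ← map_pow]
    simp
  have h2d : 0 < 2 * d := by omega
  have hαdeg : α.natDegree = 2 * d := by
    refine le_antisymm (natDegree_le_iff_coeff_eq_zero.2 fun i hi => ?_)
      (le_natDegree_of_ne_zero hαd)
    by_contra hne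
    rcases hα i hne with rfl | rfl <;> omega
  have hβdeg : β.natDegree = n * d := by
    have := congrArg natDegree hrel
    rw [natDegree_pow, natDegree_pow, hαdeg] at this
    linarith
  have hβn : β.coeff (n * d) ≠ 0 := by
    rw [← hβdeg, coeff_natDegree, Ne, leadingCoeff_eq_zero]
    rintro rfl
    simp at hβ0
  have hnd : n * d ≠ 0 := mul_ne_zero (by omega) hd
  have hodd : (α ^ n).coeff (n * d) = 0 := by
    rw [hpow, coeff_expand h2d, if_neg]
    intro hdvd
    have := Nat.dvd_of_mul_dvd_mul_right (Nat.pos_of_ne_zero hd) hdvd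
    exact (Nat.not_even_iff_odd.2 hn) (even_iff_two_dvd.2 this)
  have hsq : (β ^ 2).coeff (n * d) = 2 * β.coeff (n * d) := by
    rw [sq, coeff_mul, Finset.sum_eq_add_of_mem (0, n * d) (n * d, 0) (by simp) (by simp)
      (by simp [hnd, hnd.symm])]
    · simp [hβ0, two_mul]
    · rintro ⟨a, b⟩ hab ⟨hne1, hne2⟩
      rw [Finset.HasAntidiagonal.mem_antidiagonal] at hab
      simp only at hab ⊢
      by_contra hne
      rcases hβ a (left_ne_zero_of_mul hne) with h0 | ⟨l, hl, rfl⟩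
      · exact hne1 (by rw [← hab, h0, zero_add])
      rcases hβ b (right_ne_zero_of_mul hne) with h0 | ⟨l', hl', rfl⟩
      · exact hne2 (by rw [← hab, h0, add_zero])
      rw [← add_mul] at hab
      have := Nat.eq_of_mul_eq_mul_right (Nat.pos_of_ne_zero hd) hab
      rw [← this] at hn
      exact (Nat.not_even_iff_odd.2 hn) (hl.add_odd hl')
  have htwo : (2 : k) = 0 := by
    rw [hrel, hsq] at hodd
    exact (mul_eq_zero.1 hodd).resolve_right hβn
  have : CharP k 2 := CharTwo.of_one_ne_zero_of_two_eq_zero one_ne_zero htwo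
  have hcoeff : (α ^ n).coeff ((n - 1) * d * 2) = n * c ^ (n - 1) := by
    rw [hpow, show (n - 1) * d * 2 = (n - 1) * (2 * d) by ring, coeff_expand_mul h2d,
      comp_C_mul_X_coeff, coeff_one_add_X_pow, Nat.choose_symm_of_eq_add (b := 1) (by omega),
      Nat.choose_one_right]
  have hcoeff' : (β ^ 2).coeff ((n - 1) * d * 2) = 0 := by
    rw [← Polynomial.map_frobenius_expand, coeff_map, coeff_expand_mul two_pos]
    have : β.coeff ((n - 1) * d) = 0 := by
      by_contra hne
      rcases hβ _ hne with h0 | ⟨l, hl, hl'⟩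
      · exact mul_ne_zero (by omega) hd h0
      · rw [← Nat.eq_of_mul_eq_mul_right (Nat.pos_of_ne_zero hd) hl'] at hl
        exact (Nat.not_even_iff_odd.2 hl) (hn.tsub_odd odd_one)
    rw [this, map_zero]
  rw [hrel, hcoeff'] at hcoeff
  refine mul_ne_zero ?_ (pow_ne_zero _ hαd) hcoeff.symm
  rw [CharTwo.natCast_eq_ite, if_neg (Nat.not_even_iff_odd.2 hn)]
  exact one_ne_zero

theorem natDegree_eq_zero_of_slope (hn : 2 ≤ n) {σ : ℚ ×ₗ ℚ} (hrel : α ^ n * γ = β ^ 2)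
    (hα0 : α.coeff 0 = 1) (hβ0 : β.coeff 0 = 1) (hγ0 : γ.coeff 0 = 1)
    (hα : ∀ i, α.coeff i ≠ 0 → ∃ m, danDeg n m = danDeg n (1, 0, 0) - i • σ)
    (hβ : ∀ i, β.coeff i ≠ 0 → ∃ m, danDeg n m = danDeg n (0, 0, 1) - i • σ)
    (hαtop : ∃ m, danDeg n m = danDeg n (1, 0, 0) - α.natDegree • σ ∧
      α ^ m.1 * γ ^ m.2.1 * β ^ (m.2.2 : ℕ) = 1)
    (hβtop : ∃ m, danDeg n m = danDeg n (0, 0, 1) - β.natDegree • σ ∧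
      α ^ m.1 * γ ^ m.2.1 * β ^ (m.2.2 : ℕ) = 1) : α.natDegree = 0 := by
  by_contra hp
  have hαne : α ≠ 0 := by rintro rfl; simp at hα0
  have hβne : β ≠ 0 := by rintro rfl; simp at hβ0
  have hγne : γ ≠ 0 := by rintro rfl; simp at hγ0
  have hdegrel : n * α.natDegree + γ.natDegree = 2 * β.natDegree := by
    have := congrArg natDegree hrel
    rwa [natDegree_mul (pow_ne_zero _ hαne) hγne, natDegree_pow, natDegree_pow] at this
  have hdeg : ∀ i j e, α ^ i * γ ^ j * β ^ e = 1 →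
      i * α.natDegree + j * γ.natDegree + e * β.natDegree = 0 := by
    intro i j e heq
    have := congrArg natDegree heq
    rwa [natDegree_mul (mul_ne_zero (pow_ne_zero _ hαne) (pow_ne_zero _ hγne))
      (pow_ne_zero _ hβne), natDegree_mul (pow_ne_zero _ hαne) (pow_ne_zero _ hγne),
      natDegree_pow, natDegree_pow, natDegree_pow, natDegree_one] at this
  have hq : β.natDegree ≠ 0 := by
    intro hq
    have : 0 < n * α.natDegree := Nat.mul_pos (by omega) (by omega)
    omega
  have htop : ∀ m : ℕ × ℕ × Fin 2, α ^ m.1 * γ ^ m.2.1 * β ^ (m.2.2 : ℕ) = 1 →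
      m.1 = 0 ∧ (m.2.2 : ℕ) = 0 ∧ m.2.1 * γ.natDegree = 0 := by
    intro m hm
    have := hdeg _ _ _ hm
    exact ⟨(mul_eq_zero.1 (by omega : m.1 * α.natDegree = 0)).resolve_right hp,
      (mul_eq_zero.1 (by omega : (m.2.2 : ℕ) * β.natDegree = 0)).resolve_right hq, by omega⟩
  have hcoords : ∀ (m m' : ℕ × ℕ × Fin 2) (i : ℕ), danDeg n m = danDeg n m' - i • σ →
      (2 * m.2.1 + (m.2.2 : ℕ) : ℚ) = 2 * m'.2.1 + (m'.2.2 : ℕ) + i * (ofLex σ).1 ∧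
      (m.1 - n * m.2.1 : ℚ) = m'.1 - n * m'.2.1 - i * (ofLex σ).2 := by
    intro m m' i heq
    have h1 := congrArg (fun t => (ofLex t).1) heq
    have h2 := congrArg (fun t => (ofLex t).2) heq
    simp [danDeg] at h1 h2
    exact ⟨by linarith, by linarith⟩
  obtain ⟨⟨i, j, e⟩, hmx, hmx1⟩ := hαtop
  obtain ⟨⟨i', j', e'⟩, hmz, hmz1⟩ := hβtop
  obtain ⟨hi, he, hj⟩ := htop _ hmx1
  obtain ⟨hi', he', hj'⟩ := htop _ hmz1
  obtain ⟨hx1, hx2⟩ := hcoords _ _ _ hmx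
  obtain ⟨hz1, hz2⟩ := hcoords _ _ _ hmz
  simp only at hi he hj hi' he' hj'
  simp only [hi, he, hi', he', Fin.val_zero, Fin.val_one, Nat.cast_zero, Nat.cast_one, mul_zero,
    add_zero, zero_add, sub_zero, zero_sub] at hx1 hx2 hz1 hz2
  have hpQ : (α.natDegree : ℚ) ≠ 0 := by exact_mod_cast hp
  have hr : γ.natDegree = 0 := by
    by_contra hr
    obtain rfl := (mul_eq_zero.1 hj).resolve_right hr
    obtain rfl := (mul_eq_zero.1 hj').resolve_right hr
    have hσ : (ofLex σ).1 = 0 := by simpa [hp] using hx1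
    simp [hσ] at hz1
  have hγ1 : γ = 1 := by rw [eq_C_of_natDegree_eq_zero hr, hγ0, map_one]
  rw [hr, add_zero] at hdegrel
  have hdegQ : (n * α.natDegree : ℚ) = 2 * β.natDegree := by exact_mod_cast hdegrel
  have hnodd : Odd n := by
    have hnjQ : (n * j + 1 : ℚ) = 2 * j' := by
      have : (n * (2 * j) : ℚ) = 2 * (2 * j' - 1) := by
        rw [hx1, hz1]
        linear_combination (ofLex σ).1 * hdegQ
      linarith
    have hnj : n * j + 1 = 2 * j' := by exact_mod_cast hnjQ
    have : Odd (n * j) := by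
      rw [← Nat.not_even_iff_odd]
      rintro ⟨t, ht⟩
      omega
    exact (Nat.odd_mul.1 this).1
  have hn1 : 1 < n := by omega
  obtain ⟨d, hd⟩ : ∃ d, α.natDegree = 2 * d := by
    have : Even (n * α.natDegree) := hdegrel ▸ even_two_mul _
    exact ((Nat.even_mul.1 this).resolve_left (Nat.not_even_iff_odd.2 hnodd)).two_dvd
  have hd0 : d ≠ 0 := by omega
  have hslope : d * (2 * (ofLex σ).2 - n * (ofLex σ).1) = 1 := by
    rw [hd] at hx1 hx2
    push_cast at hx1 hx2
    linear_combination (n / 2 : ℚ) * hx1 + hx2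
  have hsupp : ∀ (m m' : ℕ × ℕ × Fin 2) (i : ℕ), danDeg n m = danDeg n m' - i • σ →
      d * (2 * m.1 + n * (m.2.2 : ℕ)) + i = d * (2 * m'.1 + n * (m'.2.2 : ℕ)) := by
    intro m m' i heq
    obtain ⟨h1, h2⟩ := hcoords _ _ _ heq
    have : (d * (2 * m.1 + n * (m.2.2 : ℕ)) + i : ℚ) = d * (2 * m'.1 + n * (m'.2.2 : ℕ)) := by
      linear_combination (d * n : ℚ) * h1 + (2 * d : ℚ) * h2 - (i : ℚ) * hslope
    exact_mod_cast this
  refine pow_ne_sq_of_coeff_support hd0 hnodd hn1 hα0 ?_ ?_ hβ0 ?_ (by rwa [hγ1, mul_one] at hrel)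
  · rwa [← hd, coeff_natDegree, Ne, leadingCoeff_eq_zero]
  · intro t ht
    obtain ⟨⟨a, b, e⟩, hm⟩ := hα t ht
    have hs := hsupp _ _ _ hm
    simp only [Fin.val_zero, mul_zero, add_zero, mul_one] at hs
    have hle : 2 * a + n * (e : ℕ) ≤ 2 := by
      by_contra! hlt
      have := Nat.mul_lt_mul_of_pos_left hlt (Nat.pos_of_ne_zero hd0)
      omega
    have hn3 : 3 ≤ n := by
      obtain ⟨s, hs⟩ := hnodd
      omega
    have he : (e : ℕ) = 0 := by
      by_contra he
      have := Nat.le_mul_of_pos_right n (Nat.pos_of_ne_zero he)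
      omega
    rw [he, mul_zero, add_zero] at hle hs
    rcases (by omega : a = 0 ∨ a = 1) with rfl | rfl <;> omega
  · intro t ht
    obtain ⟨⟨a, b, e⟩, hm⟩ := hβ t ht
    have hs := hsupp _ _ _ hm
    simp only [Fin.val_one, mul_zero, zero_add, mul_one] at hs
    fin_cases e
    · right
      simp only [mul_zero, add_zero] at hs
      have hle : 2 * a ≤ n := by
        by_contra! hlt
        have := Nat.mul_lt_mul_of_pos_left hlt (Nat.pos_of_ne_zero hd0)
        omega
      obtain ⟨s, rfl⟩ := Nat.exists_eq_add_of_le hle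
      refine ⟨s, ?_, by linarith⟩
      rcases hnodd with ⟨u, hu⟩
      exact ⟨u - a, by omega⟩
    · left
      simp only [mul_one, mul_add] at hs
      omega

end Combinatorics

section Extension

variable {k : Type*} [Field k] {n : ℕ} {h : k[X]}

/-- The extension of `danEmb` to `R[T]` giving `T` the degree `σ`. -/
def danExt (k : Type*) [Field k] (n : ℕ) (h : k[X]) (σ : ℚ ×ₗ ℚ) :
    (DanRing k n h)[X] →ₐ[k] HahnSeries (ℚ ×ₗ ℚ) k[X] :=
  eval₂AlgHom (danEmb k n h) (HahnSeries.single σ X) fun _ => Commute.all _ _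

theorem danExt_C (σ : ℚ ×ₗ ℚ) (r : DanRing k n h) : danExt k n h σ (C r) = danEmb k n h r := by
  simp [danExt]

theorem exists_hasLead_danExt {σ w : ℚ ×ₗ ℚ} {p : (DanRing k n h)[X]} {c : ℕ → k}
    (hp : ∀ i, HasLead (danEmb k n h (p.coeff i)) (w - i • σ) (C (c i))) :
    ∃ P : k[X], HasLead (danExt k n h σ p) w P ∧ ∀ i, P.coeff i = c i := by
  refine ⟨∑ i ∈ p.support, C (c i) * X ^ i, ?_, fun i => ?_⟩
  · have : danExt k n h σ p =
        ∑ i ∈ p.support, danEmb k n h (p.coeff i) * HahnSeries.single σ X ^ i := by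
      rw [danExt, eval₂AlgHom_apply, eval₂_eq_sum, Polynomial.sum]
      rfl
    rw [this]
    refine HasLead.sum fun i _ => ?_
    simpa only [sub_add_cancel] using (hp i).mul ((HasLead.single σ (X : k[X])).pow i)
  · simp only [finsetSum_coeff, coeff_C_mul_X_pow, Finset.sum_ite_eq]
    split_ifs with hi
    · rfl
    · have := hp i
      rw [notMem_support_iff.1 hi, map_zero] at this
      exact (C_eq_zero.1 (this.unique (.zero _))).symm

/-- The indices of the monomials `x`, `y`, `z`. -/
def danGen : Fin 3 → ℕ × ℕ × Fin 2 := ![(1, 0, 0), (0, 1, 0), (0, 0, 1)]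

theorem exists_isLeadTerm' (r : DanRing k n h) :
    ∃ m c, (r ≠ 0 → c ≠ 0) ∧ IsLeadTerm r m c := by
  by_cases hr : r = 0
  · exact ⟨(0, 0, 0), 0, fun h => absurd hr h, 0, by simp [hr], by simp, by simp⟩
  · obtain ⟨m, c, hc, hm⟩ := exists_isLeadTerm hr
    exact ⟨m, c, fun _ => hc, hm⟩

theorem exists_slope {φ : DanRing k n h →ₐ[k] (DanRing k n h)[X]} (hφ : IsExpMap φ)
    (hnt : ∃ g, ∃ i ≠ 0, (φ (danMon k n h (danGen g))).coeff i ≠ 0) :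
    ∃ (σ : ℚ ×ₗ ℚ) (c : Fin 3 → ℕ → k),
      (∀ g i, HasLead (danEmb k n h ((φ (danMon k n h (danGen g))).coeff i))
        (danDeg n (danGen g) - i • σ) (C (c g i))) ∧
      (∀ g i, c g i ≠ 0 → ∃ m, IsLeadTerm ((φ (danMon k n h (danGen g))).coeff i) m (c g i) ∧
        danDeg n m = danDeg n (danGen g) - i • σ) ∧
      (∀ g, c g 0 = 1) ∧ ∃ g, ∃ i ≠ 0, c g i ≠ 0 := by
  choose M L hL hM using exists_isLeadTerm' (k := k) (n := n) (h := h)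
  set a : Fin 3 → ℕ → DanRing k n h := fun g i => (φ (danMon k n h (danGen g))).coeff i with ha
  set D : Fin 3 → ℕ → ℚ ×ₗ ℚ := fun g i => danDeg n (danGen g) - danDeg n (M (a g i)) with hD
  let slope : (Σ _ : Fin 3, ℕ) → ℚ ×ₗ ℚ := fun t =>
    toLex ((ofLex (D t.1 t.2)).1 / t.2, (ofLex (D t.1 t.2)).2 / t.2)
  have hslope : ∀ g i, i ≠ 0 → i • slope ⟨g, i⟩ = D g i := by
    intro g i hi
    have hi' : (i : ℚ) ≠ 0 := by exact_mod_cast hi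
    apply ofLex.injective
    ext <;> simp [slope] <;> field_simp
  let I : Finset (Σ _ : Fin 3, ℕ) :=
    Finset.univ.sigma fun g => (φ (danMon k n h (danGen g))).support.erase 0
  have hmemI : ∀ g i, (⟨g, i⟩ : Σ _ : Fin 3, ℕ) ∈ I ↔ i ≠ 0 ∧ a g i ≠ 0 := by
    intro g i
    simp [I, ha]
  obtain ⟨g₁, i₁, hi₁, hg₁⟩ := hnt
  obtain ⟨⟨g₀, i₀⟩, hmem₀, hmax⟩ := I.exists_max_image slope ⟨⟨g₁, i₁⟩, (hmemI _ _).2 ⟨hi₁, hg₁⟩⟩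
  obtain ⟨hi₀, ha₀⟩ := (hmemI _ _).1 hmem₀
  set σ := slope ⟨g₀, i₀⟩ with hσ
  have hle : ∀ g i, i ≠ 0 → a g i ≠ 0 → danDeg n (danGen g) - i • σ ≤ danDeg n (M (a g i)) := by
    intro g i hi hgi
    have := nsmul_le_nsmul_right (hmax _ ((hmemI g i).2 ⟨hi, hgi⟩)) i
    rw [hslope g i hi] at this
    exact sub_le_comm.1 this
  have ha_zero : ∀ g, a g 0 = danMon k n h (danGen g) := fun g => hφ.coeff_zero _
  refine ⟨σ, fun g i => if i = 0 then 1 else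
    if danDeg n (danGen g) - i • σ = danDeg n (M (a g i)) then L (a g i) else 0,
    fun g i => ?_, fun g i => ?_, fun g => by simp, g₀, i₀, hi₀, ?_⟩
  · change HasLead (danEmb k n h (a g i)) _ _
    by_cases hi : i = 0
    · subst hi
      simpa [ha_zero] using (isLeadTerm_danMon (k := k) (n := n) (h := h) (danGen g)).hasLead_danEmb
    · simp only [hi, if_false]
      by_cases hgi : a g i = 0
      · have hL0 : L (a g i) = 0 := by
          have := (hM (a g i)).hasLead_danEmb
          nth_rewrite 1 [hgi] at this
          rw [map_zero] at this
          exact C_eq_zero.1 (this.unique (.zero _))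
        rw [hL0, ite_self, map_zero, hgi, map_zero]
        exact .zero _
      · rw [apply_ite C, map_zero]
        exact (hM (a g i)).hasLead_danEmb.lower_le (hle g i hi hgi)
  · change _ → ∃ m, IsLeadTerm (a g i) m _ ∧ _
    by_cases hi : i = 0
    · subst hi
      intro _
      refine ⟨danGen g, ?_, by simp⟩
      simpa [ha_zero] using isLeadTerm_danMon (k := k) (n := n) (h := h) (danGen g)
    · simp only [hi, if_false]
      split_ifs with heq
      · exact fun _ => ⟨_, hM _, heq.symm⟩
      · exact fun hne => absurd rfl hne
  · have heq : danDeg n (danGen g₀) - i₀ • σ = danDeg n (M (a g₀ i₀)) := by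
      rw [hslope g₀ i₀ hi₀, hD]
      exact sub_sub_cancel _ _
    simp only [if_neg hi₀, if_pos heq]
    exact hL _ ha₀

end Extension

section Invariants

variable {k : Type*} [Field k] {n : ℕ} {h : k[X]}
  {φ : DanRing k n h →ₐ[k] (DanRing k n h)[X]}

theorem danMon_danGen_zero : danMon k n h (danGen 0) = dx k n h := by
  simp [danMon, danGen]

theorem danMon_danGen_one : danMon k n h (danGen 1) = dy k n h := by
  simp [danMon, danGen]

theorem danMon_danGen_two : danMon k n h (danGen 2) = dz k n h := by
  simp [danMon, danGen]

theorem exists_coeff_ne_zero (hφ : IsExpMap φ) (hnt : ∃ a, φ a ≠ C a) :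
    ∃ g, ∃ i ≠ 0, (φ (danMon k n h (danGen g))).coeff i ≠ 0 := by
  by_contra! hcon
  have hC : ∀ g, φ (danMon k n h (danGen g)) = C (danMon k n h (danGen g)) := by
    intro g
    ext i
    rw [coeff_C]
    split_ifs with hi
    · rw [hi, hφ.coeff_zero]
    · exact hcon g i hi
  obtain ⟨a, ha⟩ := hnt
  apply ha
  have := danRing_algHom_ext (f := φ) (g := CAlgHom) (by simpa [danMon_danGen_zero] using hC 0)
    (by simpa [danMon_danGen_one] using hC 1) (by simpa [danMon_danGen_two] using hC 2)
  rw [this]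
  rfl

theorem mem_adjoin_of_invariant (hn : 2 ≤ n) (hφ : IsExpMap φ) (hnt : ∃ a, φ a ≠ C a)
    {f : DanRing k n h} (hf : φ f = C f) : f ∈ Algebra.adjoin k {dx k n h} := by
  by_cases hf0 : f = 0
  · exact hf0 ▸ Subalgebra.zero_mem _
  obtain ⟨σ, c, hlead, hterm, hc0, g₀, i₀, hi₀, hne⟩ :=
    exists_slope hφ (exists_coeff_ne_zero hφ hnt)
  choose P hP hPc using fun g => exists_hasLead_danExt (hlead g)
  set F := (danExt k n h σ).comp φ with hF
  have hx : HasLead (F (dx k n h)) (danDeg n (1, 0, 0)) (P 0) := by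
    exact danMon_danGen_zero (k := k) (n := n) (h := h) ▸ hP 0
  have hy : HasLead (F (dy k n h)) (danDeg n (0, 1, 0)) (P 1) := by
    exact danMon_danGen_one (k := k) (n := n) (h := h) ▸ hP 1
  have hz : HasLead (F (dz k n h)) (danDeg n (0, 0, 1)) (P 2) := by
    exact danMon_danGen_two (k := k) (n := n) (h := h) ▸ hP 2
  have hrel := lead_pow_mul_eq hx hy hz
  have hP0 : ∀ g, (P g).coeff 0 = 1 := fun g => by rw [hPc, hc0]
  have hPne : ∀ g, P g ≠ 0 := fun g h0 => by simpa [h0] using hP0 g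
  have htop : ∀ g, ∃ m, danDeg n m = danDeg n (danGen g) - (P g).natDegree • σ ∧
      P 0 ^ m.1 * P 1 ^ m.2.1 * P 2 ^ (m.2.2 : ℕ) = 1 := by
    intro g
    set p := (P g).natDegree with hp
    have hcp : c g p ≠ 0 := by
      rw [← hPc, hp, coeff_natDegree, Ne, leadingCoeff_eq_zero]
      exact hPne g
    obtain ⟨m, hm, hdeg⟩ := hterm g p hcp
    refine ⟨m, hdeg, ?_⟩
    obtain ⟨Q, hQ, hQc⟩ := exists_hasLead_danExt (σ := σ) (w := danDeg n m)
      (p := φ ((φ (danMon k n h (danGen g))).coeff p))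
      (c := fun i => (i + p).choose p * c g (i + p)) (by
        intro i
        rw [hφ.coeff_coeff, map_mul, map_natCast, hdeg, sub_sub, ← add_smul, add_comm p i]
        simpa using (hlead g (i + p)).algebraMap_mul (((i + p).choose p : ℕ) : k))
    have hQ_eq : Q = C (c g p) := by
      ext i
      rw [hQc, coeff_C]
      split_ifs with hi
      · simp [hi]
      · rw [← hPc, coeff_eq_zero_of_natDegree_lt (by omega), mul_zero]
    have := (hm.hasLead hx hy hz).unique (hQ_eq ▸ hQ)
    exact mul_left_cancel₀ (C_ne_zero.2 hcp) (this.trans (mul_one _).symm)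
  have hsupp : ∀ g i, (P g).coeff i ≠ 0 → ∃ m, danDeg n m = danDeg n (danGen g) - i • σ := by
    intro g i hi
    rw [hPc] at hi
    obtain ⟨m, -, hm⟩ := hterm g i hi
    exact ⟨m, hm⟩
  have hp : (P 0).natDegree = 0 := natDegree_eq_zero_of_slope hn hrel (hP0 0) (hP0 2) (hP0 1)
    (hsupp 0) (hsupp 2) (htop 0) (htop 2)
  have hq : (P 2).natDegree ≠ 0 := by
    intro hq
    have hr := congrArg natDegree hrel
    rw [natDegree_mul (pow_ne_zero _ (hPne 0)) (hPne 1), natDegree_pow, natDegree_pow, hp, hq,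
      mul_zero, mul_zero, zero_add] at hr
    apply hne
    rw [← hPc]
    apply coeff_eq_zero_of_natDegree_lt
    have : (P g₀).natDegree = 0 := by
      fin_cases g₀
      exacts [hp, hr, hq]
    omega
  have hr : (P 1).natDegree ≠ 0 := by
    have hr := congrArg natDegree hrel
    rw [natDegree_mul (pow_ne_zero _ (hPne 0)) (hPne 1), natDegree_pow, natDegree_pow, hp] at hr
    omega
  obtain ⟨⟨i, j, e⟩, b, hb, hm⟩ := exists_isLeadTerm hf0
  have hFf : F f = danEmb k n h f := by
    rw [hF, AlgHom.comp_apply, hf, danExt_C]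
  have hone : P 0 ^ i * P 1 ^ j * P 2 ^ (e : ℕ) = 1 := by
    have := (hm.hasLead hx hy hz).unique (hFf ▸ hm.hasLead_danEmb)
    exact mul_left_cancel₀ (C_ne_zero.2 hb) (this.trans (mul_one _).symm)
  have hdeg := congrArg natDegree hone
  rw [natDegree_mul (mul_ne_zero (pow_ne_zero _ (hPne 0)) (pow_ne_zero _ (hPne 1)))
    (pow_ne_zero _ (hPne 2)), natDegree_mul (pow_ne_zero _ (hPne 0)) (pow_ne_zero _ (hPne 1)),
    natDegree_pow, natDegree_pow, natDegree_pow, natDegree_one, hp, mul_zero, zero_add,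
    Nat.add_eq_zero_iff] at hdeg
  have hj : j = 0 := (mul_eq_zero.1 hdeg.1).resolve_right hr
  have he : e = 0 := by
    have : (e : ℕ) = 0 := (mul_eq_zero.1 hdeg.2).resolve_right hq
    omega
  subst hj he
  exact hm.mem_adjoin

end Invariants

section Transcendence

variable {k : Type*} [Field k] {n : ℕ} {h : k[X]}

theorem algebraicIndependent_dx_dy : AlgebraicIndependent k ![dx k n h, dy k n h] := by
  rw [algebraicIndependent_iff]
  intro p hp
  let ι : (Fin 2 →₀ ℕ) → ℕ × ℕ × Fin 2 := fun s => (s 0, s 1, 0)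
  have hι : Function.Injective ι := by
    intro s t hst
    simp only [ι, Prod.mk.injEq, and_true] at hst
    ext i
    fin_cases i
    exacts [hst.1, hst.2]
  have hli := (linearIndependent_danMon (k := k) (n := n) (h := h)).comp ι hι
  have hsum : ∑ s ∈ p.support, p.coeff s • (danMon k n h ∘ ι) s = 0 := by
    rw [← hp, MvPolynomial.aeval_def, MvPolynomial.eval₂_eq']
    refine Finset.sum_congr rfl fun s _ => ?_
    simp only [danMon, ι, Function.comp_apply, Fin.prod_univ_two, Matrix.cons_val_zero,
      Matrix.cons_val_one, Fin.val_zero, pow_zero, mul_one]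
    exact Algebra.smul_def (R := k) (A := DanRing k n h) _ _
  ext s
  by_cases hs : s ∈ p.support
  · exact linearIndependent_iff'.1 hli _ _ hsum s hs
  · exact MvPolynomial.notMem_support_iff.1 hs

theorem not_injective_danRing_polynomial (f : DanRing k n h →ₐ[k] k[X]) :
    ¬ Function.Injective f := by
  intro hf
  have hcard := ((algebraicIndependent_dx_dy (k := k) (n := n) (h := h)).map'
    (f := f) hf).lift_cardinalMk_le_trdeg
  rw [Polynomial.trdeg_of_isDomain] at hcard
  simp at hcard

theorem IsExpMap.map_dx {φ : DanRing k n h →ₐ[k] (DanRing k n h)[X]}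
    (hφ : IsExpMap φ) (hinv : ∀ f, φ f = C f → f ∈ Algebra.adjoin k {dx k n h}) :
    φ (dx k n h) = C (dx k n h) := by
  by_contra hx
  have ε : DanRing k n h →ₐ[k] k := danLift (a := 0) (b := 0) (c := 0) (by simp)
  refine not_injective_danRing_polynomial _ (hφ.injective_map_comp ε fun f hf => ?_)
  have hmem := hinv f hf
  rw [Algebra.adjoin_singleton_eq_range_aeval] at hmem
  obtain ⟨p, rfl⟩ := hmem
  rw [eq_C_of_natDegree_eq_zero (IsExpMap.eq_C_of_aeval hx hφ hf)]
  exact ⟨p.coeff 0, (aeval_C _ _).symm⟩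

theorem invariants_eq_adjoin {φ : DanRing k n h →ₐ[k] (DanRing k n h)[X]} (hn : 2 ≤ n)
    (hφ : IsExpMap φ) (hnt : ∃ a, φ a ≠ C a) :
    {a : DanRing k n h | φ a = C a} =
      (Algebra.adjoin k {dx k n h} : Subalgebra k (DanRing k n h)) := by
  have hinv : ∀ f, φ f = C f → f ∈ Algebra.adjoin k {dx k n h} :=
    fun f hf => mem_adjoin_of_invariant hn hφ hnt hf
  refine Set.Subset.antisymm hinv ?_
  have hle : Algebra.adjoin k {dx k n h} ≤ AlgHom.equalizer φ CAlgHom := by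
    rw [Algebra.adjoin_le_iff, Set.singleton_subset_iff]
    exact hφ.map_dx hinv
  exact fun f hf => hle hf

end Transcendence

section Shear

variable (k : Type*) [Field k] (n : ℕ) (h : k[X])

theorem adjoin_dx_dy_dz : Algebra.adjoin k {dx k n h, dy k n h, dz k n h} = ⊤ := by
  set B := Algebra.adjoin k {dx k n h, dy k n h, dz k n h}
  have hle : Submodule.span k (Set.range (danMon k n h)) ≤ Subalgebra.toSubmodule B := by
    rw [Submodule.span_le]
    rintro _ ⟨m, rfl⟩
    exact B.mul_mem (B.mul_mem (B.pow_mem (Algebra.subset_adjoin (by simp)) _)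
      (B.pow_mem (Algebra.subset_adjoin (by simp)) _))
      (B.pow_mem (Algebra.subset_adjoin (by simp)) _)
  rw [span_range_danMon] at hle
  exact eq_top_iff.2 fun a _ => hle trivial

/-- The exponential map fixing `x` and translating `z` by `x ^ n T`. -/
def danShear : DanRing k n h →ₐ[k] (DanRing k n h)[X] :=
  danLift (a := C (dx k n h))
    (b := C (dy k n h) + C (2 * dz k n h + aeval (dx k n h) h) * X + C (dx k n h ^ n) * X ^ 2)
    (c := C (dz k n h) + C (dx k n h ^ n) * X) (by
      have hrel := congrArg C (danRing_relation k n h)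
      have haeval : aeval (C (dx k n h)) h = C (aeval (dx k n h) h) :=
        aeval_algHom_apply (CAlgHom : DanRing k n h →ₐ[k] _) _ _
      rw [haeval]
      simp only [map_mul, map_add, map_pow, map_ofNat] at hrel ⊢
      linear_combination hrel)

theorem danShear_dx : danShear k n h (dx k n h) = C (dx k n h) :=
  danLift_dx _

theorem danShear_dy : danShear k n h (dy k n h) = C (dy k n h) +
    C (2 * dz k n h + aeval (dx k n h) h) * X + C (dx k n h ^ n) * X ^ 2 :=
  danLift_dy _

theorem danShear_dz : danShear k n h (dz k n h) = C (dz k n h) + C (dx k n h ^ n) * X :=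
  danLift_dz _

theorem isExpMap_danShear : IsExpMap (danShear k n h) := by
  have haeval : danShear k n h (aeval (dx k n h) h) = C (aeval (dx k n h) h) := by
    rw [← aeval_algHom_apply, danShear_dx]
    exact aeval_algHom_apply (CAlgHom : DanRing k n h →ₐ[k] _) (dx k n h) h
  refine isExpMap_of_shear (adjoin_dx_dy_dz k n h) (u := dx k n h ^ n) (w := aeval (dx k n h) h)
    (danShear_dx k n h) ?_ haeval (danShear_dy k n h) (danShear_dz k n h)
  rw [map_pow, danShear_dx, map_pow]

theorem danShear_dz_ne : danShear k n h (dz k n h) ≠ C (dz k n h) := by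
  intro heq
  rw [danShear_dz, add_eq_left] at heq
  have hx : dx k n h ^ n = 0 := by
    simpa only [coeff_C_mul_X, if_pos, coeff_zero] using congrArg (fun q => q.coeff 1) heq
  apply (linearIndependent_danMon (k := k) (n := n) (h := h)).ne_zero (n, 0, 0)
  simpa [danMon] using hx

end Shear

/-- Every nontrivial exponential map on `R` has ring of invariants `k[x]`,
and consequently `AK(R) = k[x]`. -/
theorem stmt_11 (k : Type*) [Field k] (n : ℕ) (hn : 2 ≤ n)
    (h : Polynomial k) (h0 : h.coeff 0 ≠ 0) (hdeg : h.natDegree < n) :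
    (∀ φ : DanRing k n h →ₐ[k] Polynomial (DanRing k n h), IsExpMap φ →
      (∃ a, φ a ≠ Polynomial.C a) →
      {a : DanRing k n h | φ a = Polynomial.C a} =
        (Algebra.adjoin k {dx k n h} : Subalgebra k (DanRing k n h))) ∧
    {a : DanRing k n h |
        ∀ φ : DanRing k n h →ₐ[k] Polynomial (DanRing k n h), IsExpMap φ →
          φ a = Polynomial.C a} =
      (Algebra.adjoin k {dx k n h} : Subalgebra k (DanRing k n h)) := by
  refine ⟨fun φ hφ hnt => invariants_eq_adjoin hn hφ hnt, Set.Subset.antisymm (fun a ha => ?_)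
    fun a ha φ hφ => ?_⟩
  · rw [← invariants_eq_adjoin hn (isExpMap_danShear k n h) ⟨_, danShear_dz_ne k n h⟩]
    exact ha _ (isExpMap_danShear k n h)
  · by_cases hnt : ∃ a, φ a ≠ C a
    · rw [← invariants_eq_adjoin hn hφ hnt] at ha
      exact ha
    · push Not at hnt
      exact hnt a
end
end
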